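/- Every finite simple graph G has at most 7·log₂ Δ(G) vertices of degree at least 3. -/

import Mathlib

open scoped Classical

/-- The constraint matrix `M(G) = [[I, B], [Bᵀ, I]]` of the total matching IP,
with rows and columns indexed by `V(G) ⊔ E(G)`. -/
noncomputable def totalMatrix {V : Type*} (G : SimpleGraph V) :
    Matrix (V ⊕ G.edgeSet) (V ⊕ G.edgeSet) ℤ := fun a b =>
  match a, b with
  | Sum.inl v, Sum.inl w => if v = w then 1 else 0
  | Sum.inl v, Sum.inr e => if v ∈ (e : Sym2 V) then 1 else 0
  | Sum.inr e, Sum.inl v => if v ∈ (e : Sym2 V) then 1 else 0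
  | Sum.inr e, Sum.inr f => if e = f then 1 else 0

/-- `Δ(G)`: the maximum absolute value of the determinant of a square submatrix of `M(G)`
(the empty submatrix, of determinant `1`, is allowed). -/
noncomputable def maxSubdet {V : Type*} (G : SimpleGraph V) : ℕ :=
  sSup {d : ℕ | ∃ (k : ℕ) (f g : Fin k → (V ⊕ G.edgeSet)),
    Function.Injective f ∧ Function.Injective g ∧
    d = ((totalMatrix G).submatrix f g).det.natAbs}


theorem aux_indep {V : Type*} (N : V → Finset V) (hN : ∀ v, (N v).card ≤ 3)
    (hl : ∀ v, v ∉ N v) (n : ℕ) : ∀ W : Finset V, W.card ≤ n →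
    ∃ S ⊆ W, W.card ≤ 7 * S.card ∧ ∀ u ∈ S, ∀ v ∈ S, v ∉ N u := by
  induction n with
  | zero =>
    intro W hW
    exact ⟨∅, by simp, by simpa using hW, by simp⟩
  | succ n ih =>
    intro W hW
    rcases W.eq_empty_or_nonempty with rfl | hne
    · exact ⟨∅, by simp, by simp, by simp⟩
    have hdc : ∑ v ∈ W, (W.filter fun u => v ∈ N u).card
        = ∑ u ∈ W, (W.filter fun v => v ∈ N u).card :=
      Finset.sum_card_bipartiteAbove_eq_sum_card_bipartiteBelow (fun v u => v ∈ N u)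
    have hle : ∀ u, (W.filter fun v => v ∈ N u).card ≤ 3 := fun u =>
      (Finset.card_le_card (fun x hx => (Finset.mem_filter.1 hx).2)).trans (hN u)
    have hsum : ∑ v ∈ W, (W.filter fun u => u ∈ N v ∨ v ∈ N u).card ≤ ∑ v ∈ W, 6 := by
      calc ∑ v ∈ W, (W.filter fun u => u ∈ N v ∨ v ∈ N u).card
          ≤ ∑ v ∈ W, ((W.filter fun u => u ∈ N v).card + (W.filter fun u => v ∈ N u).card) := by
            refine Finset.sum_le_sum fun v _ => ?_
            rw [Finset.filter_or]
            exact Finset.card_union_le _ _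
        _ = ∑ u ∈ W, ((W.filter fun v => v ∈ N u).card + (W.filter fun v => v ∈ N u).card) := by
            rw [Finset.sum_add_distrib, hdc, ← Finset.sum_add_distrib]
        _ ≤ ∑ v ∈ W, 6 := Finset.sum_le_sum fun v _ => by have := hle v; omega
    obtain ⟨v, hv, hv6⟩ := Finset.exists_le_of_sum_le hne hsum
    set D := insert v (W.filter fun u => u ∈ N v ∨ v ∈ N u) with hD
    have hDc : D.card ≤ 7 := (Finset.card_insert_le _ _).trans (by omega)
    have hvD : v ∈ D := by simp [hD]
    have hlt : (W \ D).card < W.card :=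
      Finset.card_lt_card ⟨Finset.sdiff_subset, fun h => (Finset.mem_sdiff.1 (h hv)).2 hvD⟩
    obtain ⟨S, hSW, hSc, hS⟩ := ih (W \ D) (by omega)
    have hvS : v ∉ S := fun h => (Finset.mem_sdiff.1 (hSW h)).2 hvD
    have hnb : ∀ u ∈ S, u ∉ N v ∧ v ∉ N u := by
      intro u hu
      have h := Finset.mem_sdiff.1 (hSW hu)
      have h2 := h.2
      simp only [hD, Finset.mem_insert, Finset.mem_filter, not_or, not_and] at h2
      exact h2.2 h.1
    refine ⟨insert v S, ?_, ?_, ?_⟩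
    · intro x hx
      rcases Finset.mem_insert.1 hx with rfl | hx
      · exact hv
      · exact (Finset.mem_sdiff.1 (hSW hx)).1
    · rw [Finset.card_insert_of_notMem hvS]
      have := Finset.card_le_card_sdiff_add_card (s := W) (t := D)
      omega
    · intro u hu w hw
      rcases Finset.mem_insert.1 hu with hu2 | hu2 <;> rcases Finset.mem_insert.1 hw with hw2 | hw2
      · rw [hu2, hw2]; exact hl _
      · rw [hu2]; exact (hnb w hw2).1
      · rw [hw2]; exact (hnb u hu2).2
      · exact hS u hu2 w hw2

theorem aux_bdd {V : Type*} [Fintype V] (G : SimpleGraph V) :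
    BddAbove {d : ℕ | ∃ (k : ℕ) (f g : Fin k → (V ⊕ G.edgeSet)),
    Function.Injective f ∧ Function.Injective g ∧
    d = ((totalMatrix G).submatrix f g).det.natAbs} := by
  apply Set.Finite.bddAbove
  let F : (Σ k : Fin (Fintype.card (V ⊕ G.edgeSet) + 1),
    (Fin k → (V ⊕ G.edgeSet)) × (Fin k → (V ⊕ G.edgeSet))) → ℕ :=
    fun x => ((totalMatrix G).submatrix x.2.1 x.2.2).det.natAbs
  refine (Set.finite_range F).subset ?_
  rintro d ⟨k, f, g, hf, hg, rfl⟩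
  have hk : k ≤ Fintype.card (V ⊕ G.edgeSet) := by
    simpa using Fintype.card_le_of_injective f hf
  exact ⟨⟨⟨k, by omega⟩, f, g⟩, rfl⟩

theorem aux_det {V : Type*} [Fintype V] (G : SimpleGraph V) (N : V → Finset V) (S : Finset V)
    (hN : ∀ v ∈ S, (N v).card = 3) (hadj : ∀ v, ∀ w ∈ N v, G.Adj v w)
    (hS : ∀ u ∈ S, ∀ v ∈ S, v ∉ N u) : 2 ^ S.card ≤ maxSubdet G := by
  let e : ∀ v : S, Fin 3 ≃ N v := fun v => ((N v).equivFinOfCardEq (hN v v.2)).symm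
  let f : S ⊕ (S × Fin 3) → V ⊕ G.edgeSet := Sum.elim (fun v => Sum.inl v)
    (fun p => Sum.inr ⟨s((p.1 : V), (e p.1 p.2 : V)), (G.mem_edgeSet).2 (hadj _ _ (e p.1 p.2).2)⟩)
  have hne : ∀ (u v : S) (i : Fin 3), (u : V) ≠ (e v i : V) := fun u v i h =>
    hS v v.2 u u.2 (h ▸ (e v i).2)
  have hinj : ∀ p q : S × Fin 3, s((p.1 : V), (e p.1 p.2 : V)) = s((q.1 : V), (e q.1 q.2 : V)) →
      p = q := by
    rintro ⟨u, i⟩ ⟨v, j⟩ h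
    rcases Sym2.eq_iff.1 h with ⟨h1, h2⟩ | ⟨h1, h2⟩
    · have : u = v := Subtype.ext h1
      subst this
      have : i = j := (e u).injective (Subtype.ext h2)
      rw [this]
    · exact absurd h1 (hne _ _ _)
  have hf : Function.Injective f := by
    rintro (u | p) (v | q) h
    · simp only [f, Sum.elim_inl, Sum.inl.injEq] at h
      rw [Subtype.ext h]
    · simp [f] at h
    · simp [f] at h
    · simp only [f, Sum.elim_inr, Sum.inr.injEq] at h
      rw [hinj p q (congrArg Subtype.val h)]
  let B : Matrix S (S × Fin 3) ℤ := fun v p => if v = p.1 then 1 else 0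
  have hmem : ∀ (v : S) (p : S × Fin 3),
      ((v : V) ∈ s((p.1 : V), (e p.1 p.2 : V))) ↔ v = p.1 := by
    intro v p
    rw [Sym2.mem_iff]
    constructor
    · rintro (h | h)
      · exact Subtype.ext h
      · exact absurd h (hne _ _ _)
    · rintro rfl
      exact Or.inl rfl
  have hM : (totalMatrix G).submatrix f f = Matrix.fromBlocks 1 B B.transpose 1 := by
    ext (u | p) (v | q)
    · change (if (u : V) = v then (1 : ℤ) else 0) = (1 : Matrix S S ℤ) u v
      rw [Matrix.one_apply]
      exact if_congr Subtype.ext_iff.symm rfl rfl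
    · exact if_congr (hmem u q) rfl rfl
    · exact if_congr (hmem v p) rfl rfl
    · change _ = (1 : Matrix (S × Fin 3) (S × Fin 3) ℤ) p q
      rw [Matrix.one_apply]
      exact if_congr ⟨fun h => hinj p q (congrArg Subtype.val h), fun h => by rw [h]⟩ rfl rfl
  have hBB : (1 : Matrix S S ℤ) - B * B.transpose = Matrix.diagonal (fun _ => (-2 : ℤ)) := by
    ext u v
    rw [Matrix.sub_apply, Matrix.mul_apply, Fintype.sum_prod_type]
    have h1 : ∀ (w : S) (i : Fin 3), B u (w, i) * B.transpose (w, i) v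
        = if u = w then (if v = w then 1 else 0) else 0 := by
      intro w i
      change (if u = w then (1 : ℤ) else 0) * (if v = w then (1 : ℤ) else 0) = _
      rw [ite_mul, one_mul, zero_mul]
    simp only [h1]
    by_cases h : u = v
    · subst h
      simp
    · have hsymm : v ≠ u := fun a => h a.symm
      simp [h, hsymm]
  have hdet : ((totalMatrix G).submatrix f f).det.natAbs = 2 ^ S.card := by
    rw [hM, Matrix.det_fromBlocks_one₂₂, hBB, Matrix.det_diagonal]
    simp [Int.natAbs_pow]
  let φ := (Fintype.equivFin (S ⊕ (S × Fin 3))).symm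
  refine le_csSup (aux_bdd G) ⟨_, f ∘ φ, f ∘ φ, hf.comp φ.injective, hf.comp φ.injective, ?_⟩
  rw [← hdet, ← Matrix.submatrix_submatrix, Matrix.det_submatrix_equiv_self]

/-- Every finite simple graph `G` has at most `7 · log₂ Δ(G)` vertices of degree at
least `3`. -/
theorem stmt11 {V : Type*} [Fintype V] (G : SimpleGraph V) [DecidableRel G.Adj] :
    ((Finset.univ.filter fun v => 3 ≤ G.degree v).card : ℝ) ≤
      7 * Real.logb 2 (maxSubdet G) := by
  have hex : ∀ v, ∃ T ⊆ G.neighborFinset v, T.card = min 3 (G.degree v) := fun v =>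
    Finset.exists_subset_card_eq (by rw [G.card_neighborFinset_eq_degree]; exact min_le_right _ _)
  choose N hNsub hNc using hex
  have hadj : ∀ v, ∀ w ∈ N v, G.Adj v w := fun v w hw =>
    (G.mem_neighborFinset v w).1 (hNsub v hw)
  obtain ⟨S, hSW, hSc, hS⟩ := aux_indep N (fun v => by rw [hNc]; exact min_le_left _ _)
    (fun v hv => G.loopless.irrefl v (hadj v v hv)) _
    (Finset.univ.filter fun v => 3 ≤ G.degree v) le_rfl
  have h2 := aux_det G N S (fun v hv => by
    rw [hNc]; exact min_eq_left (Finset.mem_filter.1 (hSW hv)).2) hadj hS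
  have h3 : (S.card : ℝ) ≤ Real.logb 2 (maxSubdet G) := by
    have h4 : ((2 : ℝ) ^ S.card) ≤ (maxSubdet G : ℝ) := by exact_mod_cast h2
    rw [Real.le_logb_iff_rpow_le (by norm_num) (lt_of_lt_of_le (by positivity) h4),
      Real.rpow_natCast]
    exact h4
  have h5 : ((Finset.univ.filter fun v => 3 ≤ G.degree v).card : ℝ) ≤ 7 * S.card := by
    exact_mod_cast hSc
  linarith
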